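/- arXiv:2306.16170 — 4 statements merged into one kernel-verified Lean document; each statement's English description precedes it below -/
import Mathlib

section
/- (Proof A.1 of the paper: Eq. (15).) Fix C ≥ 1 and logits z : Fin C → ℝ. For τ > 0 define q j (τ) = exp (z j / τ), the tempered softmax probabilities p k (τ) = q k (τ) / ∑ j, q j (τ), and the entropy H(τ) = −∑ k, p k (τ) * log (p k (τ)). Then for every τ > 0, the function H has derivative at τ equal to [ (∑ j, q j (τ)) * (∑ j, q j (τ) * (log (q j (τ)))²) − (∑ j, q j (τ) * log (q j (τ)))² ] / ( τ * (∑ j, q j (τ))² ). -/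
/-- The entropy of a softmax is the log-partition function minus the mean logit. -/
theorem entropy_softmax_eq {ι : Type*} [Fintype ι] [Nonempty ι] (a : ι → ℝ) :
    -∑ k, (Real.exp (a k) / ∑ j, Real.exp (a j)) *
        Real.log (Real.exp (a k) / ∑ j, Real.exp (a j)) =
      Real.log (∑ j, Real.exp (a j)) -
        (∑ j, Real.exp (a j) * a j) / ∑ j, Real.exp (a j) := by
  have hS : 0 < ∑ j, Real.exp (a j) :=
    Finset.sum_pos (fun j _ => Real.exp_pos _) Finset.univ_nonempty
  have hterm (k : ι) : (Real.exp (a k) / ∑ j, Real.exp (a j)) *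
      Real.log (Real.exp (a k) / ∑ j, Real.exp (a j)) =
      (Real.exp (a k) * a k) / (∑ j, Real.exp (a j)) -
        Real.exp (a k) / (∑ j, Real.exp (a j)) * Real.log (∑ j, Real.exp (a j)) := by
    rw [Real.log_div (Real.exp_ne_zero _) hS.ne', Real.log_exp]
    ring
  simp_rw [hterm]
  rw [Finset.sum_sub_distrib, ← Finset.sum_mul, ← Finset.sum_div, ← Finset.sum_div,
    div_self hS.ne']
  ring

/-- Derivative of the entropy of a softmax with respect to the inverse temperature. -/
theorem entropy_hasDerivAt_inverse_temperature {ι : Type*} [Fintype ι] [Nonempty ι]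
    (z : ι → ℝ) (u : ℝ) :
    HasDerivAt
      (fun s : ℝ => -∑ k, (Real.exp (z k * s) / ∑ j, Real.exp (z j * s)) *
        Real.log (Real.exp (z k * s) / ∑ j, Real.exp (z j * s)))
      (-u * ((∑ j, Real.exp (z j * u)) * (∑ j, Real.exp (z j * u) * z j ^ 2) -
          (∑ j, Real.exp (z j * u) * z j) ^ 2) / (∑ j, Real.exp (z j * u)) ^ 2) u := by
  have hS : 0 < ∑ j, Real.exp (z j * u) :=
    Finset.sum_pos (fun j _ => Real.exp_pos _) Finset.univ_nonempty
  have hexp (j : ι) : HasDerivAt (fun s : ℝ => Real.exp (z j * s))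
      (Real.exp (z j * u) * z j) u := by
    simpa using ((hasDerivAt_id u).const_mul (z j)).exp
  have hsum : HasDerivAt (fun s : ℝ => ∑ j, Real.exp (z j * s))
      (∑ j, Real.exp (z j * u) * z j) u :=
    HasDerivAt.fun_sum fun j _ => hexp j
  have hmean : HasDerivAt (fun s : ℝ => ∑ j, Real.exp (z j * s) * z j)
      (∑ j, Real.exp (z j * u) * z j ^ 2) u := by
    refine HasDerivAt.fun_sum fun j _ => ?_
    simpa only [pow_two, mul_assoc] using (hexp j).mul_const (z j)
  have hfun (s : ℝ) : -∑ k, (Real.exp (z k * s) / ∑ j, Real.exp (z j * s)) *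
        Real.log (Real.exp (z k * s) / ∑ j, Real.exp (z j * s)) =
      Real.log (∑ j, Real.exp (z j * s)) -
        s * (∑ j, Real.exp (z j * s) * z j) / ∑ j, Real.exp (z j * s) := by
    rw [entropy_softmax_eq fun j => z j * s, Finset.mul_sum]
    congr 2
    exact Finset.sum_congr rfl fun j _ => by ring
  simp_rw [hfun]
  refine ((hsum.log hS.ne').fun_sub
    (((hasDerivAt_id' u).fun_mul hmean).fun_div hsum hS.ne')).congr_deriv ?_
  generalize (∑ j, Real.exp (z j * u)) = S at hS ⊢
  generalize (∑ j, Real.exp (z j * u) * z j) = S₁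
  field_simp
  ring

/-- Eq. (15): derivative of the entropy of the tempered softmax with respect to
the temperature. -/
theorem entropy_hasDerivAt_temperature (C : ℕ) (hC : 1 ≤ C) (z : Fin C → ℝ)
    (τ : ℝ) (hτ : 0 < τ) :
    HasDerivAt
      (fun t : ℝ => -∑ k, (Real.exp (z k / t) / ∑ j, Real.exp (z j / t)) *
        Real.log (Real.exp (z k / t) / ∑ j, Real.exp (z j / t)))
      (((∑ j, Real.exp (z j / τ)) *
          (∑ j, Real.exp (z j / τ) * (Real.log (Real.exp (z j / τ))) ^ 2) -
          (∑ j, Real.exp (z j / τ) * Real.log (Real.exp (z j / τ))) ^ 2) /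
        (τ * (∑ j, Real.exp (z j / τ)) ^ 2)) τ := by
  have : Nonempty (Fin C) := ⟨⟨0, hC⟩⟩
  have hS : 0 < ∑ j, Real.exp (z j * τ⁻¹) :=
    Finset.sum_pos (fun j _ => Real.exp_pos _) Finset.univ_nonempty
  simp only [Real.log_exp, div_eq_mul_inv (z _), mul_pow, ← mul_assoc, ← Finset.sum_mul]
  refine ((entropy_hasDerivAt_inverse_temperature z τ⁻¹).comp τ
    (hasDerivAt_inv hτ.ne')).congr_deriv ?_
  generalize (∑ j, Real.exp (z j * τ⁻¹)) = S at hS ⊢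
  field_simp
end

section
/- (Monotonicity claim of Section III-B.) Fix C ≥ 1 and logits z : Fin C → ℝ. The information entropy of the tempered softmax distribution is monotonically increasing in the temperature: the function τ ↦ H(τ) = −∑ k, p k (τ) * log (p k (τ)) is monotone nondecreasing on the interval (0, ∞), where p k (τ) = exp (z k / τ) / ∑ j, exp (z j / τ). -/
/-- **Gibbs' inequality** for strictly positive weights of equal total mass. -/
theorem sum_mul_log_le_sum_mul_log {ι : Type*} [Fintype ι] {p q : ι → ℝ}
    (hp : ∀ i, 0 < p i) (hq : ∀ i, 0 < q i) (hpq : ∑ i, q i = ∑ i, p i) :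
    ∑ i, p i * Real.log (q i) ≤ ∑ i, p i * Real.log (p i) := by
  have key : ∀ i, p i * Real.log (q i) - p i * Real.log (p i) ≤ q i - p i := fun i => by
    have h := mul_le_mul_of_nonneg_left
      (Real.log_le_sub_one_of_pos (div_pos (hq i) (hp i))) (hp i).le
    rw [Real.log_div (hq i).ne' (hp i).ne', mul_sub, mul_sub, mul_div_cancel₀ _ (hp i).ne',
      mul_one] at h
    exact h
  have h := Finset.sum_le_sum fun i (_ : i ∈ Finset.univ) => key i
  rw [Finset.sum_sub_distrib, Finset.sum_sub_distrib, hpq] at h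
  linarith

/-- The cross term of a probability vector with the logarithm of a tempered softmax. -/
theorem sum_mul_log_softmax {ι : Type*} [Fintype ι] [Nonempty ι] (z p : ι → ℝ)
    (hp : ∑ i, p i = 1) (τ : ℝ) :
    ∑ k, p k * Real.log (Real.exp (z k / τ) / ∑ j, Real.exp (z j / τ)) =
      τ⁻¹ * ∑ k, p k * z k - Real.log (∑ j, Real.exp (z j / τ)) := by
  have hZ : 0 < ∑ j, Real.exp (z j / τ) :=
    Finset.sum_pos (fun _ _ => Real.exp_pos _) Finset.univ_nonempty
  simp_rw [Real.log_div (Real.exp_pos _).ne' hZ.ne', Real.log_exp, mul_sub]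
  rw [Finset.sum_sub_distrib, ← Finset.sum_mul, hp, one_mul, Finset.mul_sum]
  congr 1
  exact Finset.sum_congr rfl fun k _ => by ring

/-- The entropy of the tempered softmax distribution is monotone nondecreasing
in the temperature on `(0, ∞)`. -/
theorem entropy_monotoneOn_temperature (C : ℕ) (hC : 1 ≤ C) (z : Fin C → ℝ) :
    MonotoneOn
      (fun τ : ℝ => -∑ k, (Real.exp (z k / τ) / ∑ j, Real.exp (z j / τ)) *
        Real.log (Real.exp (z k / τ) / ∑ j, Real.exp (z j / τ)))
      (Set.Ioi (0 : ℝ)) := by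
  have : Nonempty (Fin C) := ⟨⟨0, hC⟩⟩
  intro s hs t ht hst
  rcases hst.eq_or_lt with rfl | hlt
  · exact le_rfl
  have hZ : ∀ τ : ℝ, 0 < ∑ j, Real.exp (z j / τ) := fun τ =>
    Finset.sum_pos (fun _ _ => Real.exp_pos _) Finset.univ_nonempty
  have hpos : ∀ (τ : ℝ) (k : Fin C), 0 < Real.exp (z k / τ) / ∑ j, Real.exp (z j / τ) :=
    fun τ k => div_pos (Real.exp_pos _) (hZ τ)
  have hsum : ∀ τ : ℝ, ∑ k, Real.exp (z k / τ) / ∑ j, Real.exp (z j / τ) = 1 := fun τ => by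
    rw [← Finset.sum_div, div_self (hZ τ).ne']
  have hgibbs := fun σ τ : ℝ =>
    sum_mul_log_le_sum_mul_log (hpos σ) (hpos τ) ((hsum τ).trans (hsum σ).symm)
  have hs_t := hgibbs s t
  have ht_s := hgibbs t s
  simp only [sum_mul_log_softmax z _ (hsum _)] at hs_t ht_s ⊢
  have hinv : t⁻¹ < s⁻¹ := inv_strictAnti₀ hs hlt
  have ht0 : 0 < t⁻¹ := inv_pos.mpr ht
  set Es := ∑ k, (Real.exp (z k / s) / ∑ j, Real.exp (z j / s)) * z k
  set Et := ∑ k, (Real.exp (z k / t) / ∑ j, Real.exp (z j / t)) * z k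
  have hmean : Et ≤ Es := by
    refine le_of_mul_le_mul_left ?_ (sub_pos.mpr hinv)
    linarith
  have := mul_le_mul_of_nonneg_left hmean ht0.le
  linarith
end

section
/- (Low-temperature entropy limit.) Fix C ≥ 1 and logits z : Fin C → ℝ with a unique maximizer k0 (i.e., z k < z k0 for every k ≠ k0). Then the entropy of the tempered softmax distribution tends to 0 as the temperature tends to 0 from the right: H(τ) = −∑ k, p k (τ) * log (p k (τ)) → 0 as τ → 0+, where p k (τ) = exp (z k / τ) / ∑ j, exp (z j / τ). -/
/-- Softmax weights are invariant under shifting all logits by a constant. -/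
theorem softmax_eq_shift {ι : Type*} [Fintype ι] (z : ι → ℝ) (c τ : ℝ) (k : ι) :
    Real.exp (z k / τ) / ∑ j, Real.exp (z j / τ) =
      Real.exp ((z k - c) / τ) / ∑ j, Real.exp ((z j - c) / τ) := by
  simp only [sub_div, Real.exp_sub, ← Finset.sum_div]
  rw [div_div_div_cancel_right₀ (Real.exp_ne_zero _)]

/-- For negative `a`, `exp (a / τ)` tends to `0` as `τ` tends to `0⁺`. -/
theorem tendsto_exp_div_nhdsGT_zero {a : ℝ} (ha : a < 0) :
    Filter.Tendsto (fun τ : ℝ => Real.exp (a / τ)) (nhdsWithin 0 (Set.Ioi 0)) (nhds 0) := by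
  simp only [div_eq_mul_inv]
  exact Real.tendsto_exp_atBot.comp (tendsto_inv_nhdsGT_zero.const_mul_atTop_of_neg ha)

/-- As the temperature tends to `0⁺`, the tempered softmax distribution of logits with a unique
maximizer concentrates at that maximizer. -/
theorem tendsto_softmax_nhdsGT_zero {ι : Type*} [Fintype ι] [DecidableEq ι] (z : ι → ℝ)
    (k0 : ι) (hmax : ∀ k, k ≠ k0 → z k < z k0) (k : ι) :
    Filter.Tendsto (fun τ : ℝ => Real.exp (z k / τ) / ∑ j, Real.exp (z j / τ))
      (nhdsWithin 0 (Set.Ioi 0)) (nhds (if k = k0 then 1 else 0)) := by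
  have key (j : ι) : Filter.Tendsto (fun τ : ℝ => Real.exp ((z j - z k0) / τ))
      (nhdsWithin 0 (Set.Ioi 0)) (nhds (if j = k0 then 1 else 0)) := by
    by_cases hj : j = k0
    · simp [hj]
    · simpa [hj] using tendsto_exp_div_nhdsGT_zero (sub_neg.2 (hmax j hj))
  simp only [softmax_eq_shift z (z k0)]
  have h := (key k).div (tendsto_finsetSum Finset.univ fun j _ => key j) (by simp)
  simp only [Finset.sum_ite_eq', Finset.mem_univ, if_true, div_one] at h
  exact h

/-- The entropy of the tempered softmax distribution tends to `0` as the
temperature tends to `0⁺`, when the logits have a unique maximizer. -/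
theorem entropy_tendsto_zero_zero (C : ℕ) (hC : 1 ≤ C) (z : Fin C → ℝ)
    (k0 : Fin C) (hmax : ∀ k, k ≠ k0 → z k < z k0) :
    Filter.Tendsto
      (fun τ : ℝ => -∑ k, (Real.exp (z k / τ) / ∑ j, Real.exp (z j / τ)) *
        Real.log (Real.exp (z k / τ) / ∑ j, Real.exp (z j / τ)))
      (nhdsWithin 0 (Set.Ioi 0)) (nhds 0) := by
  have h := (tendsto_finsetSum Finset.univ fun k _ =>
    (Real.continuous_mul_log.tendsto _).comp (tendsto_softmax_nhdsGT_zero z k0 hmax k)).neg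
  have hzero : -∑ k, (if k = k0 then (1 : ℝ) else 0) * Real.log (if k = k0 then 1 else 0) = 0 := by
    simp
  rw [hzero] at h
  exact h
end

section
/- (Strict version of the monotonicity used to justify estimating ∇_τ H by a positive constant.) Fix C ≥ 1 and logits z : Fin C → ℝ that are not all equal (there exist j, k with z j ≠ z k). Then for every τ > 0 the derivative of the entropy of the tempered softmax distribution is strictly positive: (∑ j, q j (τ)) * (∑ j, q j (τ) * (log (q j (τ)))²) − (∑ j, q j (τ) * log (q j (τ)))² > 0, where q j (τ) = exp (z j / τ); consequently τ ↦ H(τ) is strictly monotone increasing on (0, ∞). -/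
open Finset in
/-- Strict Cauchy-Schwarz inequality for positive weights: a nonconstant function has positive
weighted variance. -/
theorem weighted_variance_pos {ι : Type*} [Fintype ι] {w x : ι → ℝ} (hw : ∀ i, 0 < w i)
    (hx : ∃ i j, x i ≠ x j) :
    0 < (∑ i, w i) * (∑ i, w i * x i ^ 2) - (∑ i, w i * x i) ^ 2 := by
  obtain ⟨i, j, hij⟩ := hx
  have hW : 0 < ∑ i, w i := sum_pos (fun i _ => hw i) ⟨i, mem_univ i⟩
  set m := (∑ i, w i * x i) / ∑ i, w i with hm
  have hmean : ∑ i, w i * x i = m * ∑ i, w i := by rw [hm]; field_simp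
  have hvar : 0 < ∑ i, w i * (x i - m) ^ 2 := by
    obtain ⟨k, hk⟩ : ∃ k, x k ≠ m := by
      by_contra! h
      exact hij ((h i).trans (h j).symm)
    exact sum_pos' (fun i _ => mul_nonneg (hw i).le (sq_nonneg _))
      ⟨k, mem_univ k, mul_pos (hw k) (sq_pos_of_ne_zero (sub_ne_zero.mpr hk))⟩
  have hexpand : ∑ i, w i * (x i - m) ^ 2 =
      ∑ i, w i * x i ^ 2 - 2 * m * ∑ i, w i * x i + m ^ 2 * ∑ i, w i := by
    simp only [mul_sum, ← sum_sub_distrib, ← sum_add_distrib]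
    exact sum_congr rfl fun i _ => by ring
  have := mul_pos hW hvar
  rw [hexpand, hmean] at this
  rw [hmean]
  linarith

/-- The Gibbs entropy `log Z - β ⟨z⟩` is strictly decreasing in the inverse temperature `β`. -/
theorem gibbs_entropy_strictAntiOn {ι : Type*} [Fintype ι] {z : ι → ℝ}
    (hz : ∃ i j, z i ≠ z j) :
    StrictAntiOn (fun β : ℝ => Real.log (∑ i, Real.exp (z i * β)) -
      β * ((∑ i, Real.exp (z i * β) * z i) / ∑ i, Real.exp (z i * β))) (Set.Ioi 0) := by
  have : Nonempty ι := ⟨hz.choose⟩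
  have hZ (β : ℝ) : 0 < ∑ i, Real.exp (z i * β) :=
    Finset.sum_pos (fun i _ => Real.exp_pos _) Finset.univ_nonempty
  have hexp (i : ι) (β : ℝ) :
      HasDerivAt (fun β => Real.exp (z i * β)) (Real.exp (z i * β) * z i) β := by
    simpa using ((hasDerivAt_id β).const_mul (z i)).exp
  have hderiv (β : ℝ) := (HasDerivAt.fun_sum fun i (_ : i ∈ Finset.univ) => hexp i β)
  have hderiv₂ (β : ℝ) :=
    (HasDerivAt.fun_sum fun i (_ : i ∈ Finset.univ) => (hexp i β).mul_const (z i))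
  have hH (β : ℝ) : HasDerivAt (fun β : ℝ => Real.log (∑ i, Real.exp (z i * β)) -
      β * ((∑ i, Real.exp (z i * β) * z i) / ∑ i, Real.exp (z i * β)))
      (-(β * (((∑ i, Real.exp (z i * β)) * (∑ i, Real.exp (z i * β) * z i ^ 2) -
        (∑ i, Real.exp (z i * β) * z i) ^ 2) / (∑ i, Real.exp (z i * β)) ^ 2))) β := by
    refine (((hderiv β).log (hZ β).ne').fun_sub
      ((hasDerivAt_id' β).fun_mul
        ((hderiv₂ β).fun_div (hderiv β) (hZ β).ne'))).congr_deriv ?_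
    simp only [mul_assoc, ← pow_two]
    ring
  refine strictAntiOn_of_deriv_neg (convex_Ioi 0)
    (fun β _ => (hH β).continuousAt.continuousWithinAt) fun β hβ => ?_
  rw [interior_Ioi, Set.mem_Ioi] at hβ
  rw [(hH β).deriv, neg_lt_zero]
  exact mul_pos hβ (div_pos (weighted_variance_pos (fun i => Real.exp_pos (z i * β)) hz)
    (pow_pos (hZ β) 2))

/-- The Shannon entropy of a softmax distribution is `log Z` minus the mean of the logits. -/
theorem softmax_entropy_eq {ι : Type*} [Fintype ι] [Nonempty ι] (a : ι → ℝ) :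
    -∑ k, (Real.exp (a k) / ∑ j, Real.exp (a j)) *
        Real.log (Real.exp (a k) / ∑ j, Real.exp (a j)) =
      Real.log (∑ j, Real.exp (a j)) -
        (∑ k, Real.exp (a k) * a k) / ∑ j, Real.exp (a j) := by
  have hZ : 0 < ∑ j, Real.exp (a j) :=
    Finset.sum_pos (fun i _ => Real.exp_pos _) Finset.univ_nonempty
  simp only [Real.log_div (Real.exp_ne_zero _) hZ.ne', Real.log_exp, mul_sub,
    Finset.sum_sub_distrib, ← Finset.sum_mul, ← Finset.sum_div, div_mul_eq_mul_div]
  field_simp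
  ring


/-- Strict monotonicity: if the logits are not all equal, the numerator of the
entropy derivative is strictly positive at every temperature, and the tempered
softmax entropy is strictly increasing in the temperature on `(0, ∞)`. -/
theorem entropy_strictMono_temperature (C : ℕ) (hC : 1 ≤ C) (z : Fin C → ℝ)
    (hne : ∃ j k, z j ≠ z k) :
    (∀ τ : ℝ, 0 < τ →
      0 < (∑ j, Real.exp (z j / τ)) *
          (∑ j, Real.exp (z j / τ) * (Real.log (Real.exp (z j / τ))) ^ 2) -
          (∑ j, Real.exp (z j / τ) * Real.log (Real.exp (z j / τ))) ^ 2) ∧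
    StrictMonoOn
      (fun τ : ℝ => -∑ k, (Real.exp (z k / τ) / ∑ j, Real.exp (z j / τ)) *
        Real.log (Real.exp (z k / τ) / ∑ j, Real.exp (z j / τ)))
      (Set.Ioi (0 : ℝ)) := by
  have : Nonempty (Fin C) := ⟨⟨0, hC⟩⟩
  refine ⟨fun τ hτ => ?_, fun s hs t ht hst => ?_⟩
  · simp only [Real.log_exp]
    obtain ⟨j, k, hjk⟩ := hne
    exact weighted_variance_pos (fun i => Real.exp_pos (z i / τ))
      ⟨j, k, fun h => hjk ((div_left_inj' hτ.ne').mp h)⟩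
  · have h := gibbs_entropy_strictAntiOn hne (Set.mem_Ioi.mpr (inv_pos.mpr ht))
      (Set.mem_Ioi.mpr (inv_pos.mpr hs)) (inv_strictAnti₀ hs hst)
    simp only [softmax_entropy_eq]
    have hmean (τ : ℝ) : (∑ k, Real.exp (z k / τ) * (z k / τ)) / ∑ j, Real.exp (z j / τ) =
        τ⁻¹ * ((∑ k, Real.exp (z k * τ⁻¹) * z k) / ∑ j, Real.exp (z j * τ⁻¹)) := by
      simp only [div_eq_mul_inv, ← mul_assoc, ← Finset.sum_mul]
      ring
    rw [hmean, hmean]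
    simpa only [div_eq_mul_inv] using h
end
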